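/- Let X be a nonempty set and let φ_0, …, φ_k : X → ℝ be functions each of which attains its infimum on X. Suppose the minimizer sets are strictly nested: argmin(φ_0) ⊋ argmin(φ_1) ⊋ ⋯ ⊋ argmin(φ_k), where argmin(φ) = {x ∈ X : φ(x) = inf_X φ}. Then the set {φ_0, …, φ_k} is tropically independent (it has k+1 distinct elements and no tropical dependence exists among them). This is the core of the paper's Lemma stating that, for a tropical submodule Σ, every chain of strict inclusions among the sets F_φ (φ ∈ Σ) has length at most r_ind(Σ) − 1. -/

import Mathlib

/-- The tropical span of a set `S` of functions `X → ℝ ∪ {∞}`: all finite tropical linear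
combinations `min_k (φ_k + a_k)` with `φ_k ∈ S`, `a_k ∈ ℝ ∪ {∞}` (the empty combination is the
constant function `∞`). -/
noncomputable def tropSpan {X : Type*} (S : Set (X → WithTop ℝ)) : Set (X → WithTop ℝ) :=
  { f | ∃ (n : ℕ) (φ : Fin n → (X → WithTop ℝ)) (a : Fin n → WithTop ℝ),
      (∀ k, φ k ∈ S) ∧ f = fun x => Finset.univ.inf (fun k => φ k x + a k) }

/-- A finite set `T` of functions `X → ℝ ∪ {∞}` is tropically dependent if there are real
numbers `a_f` (for `f ∈ T`) such that at every point `x` the minimum `min_{f ∈ T} (f x + a_f)`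
is attained by at least two distinct elements of `T`. -/
def TropicallyDependent {X : Type*} (T : Finset (X → WithTop ℝ)) : Prop :=
  ∃ a : (X → WithTop ℝ) → ℝ, ∀ x : X, ∃ f ∈ T, ∃ g ∈ T, f ≠ g ∧
    f x + (a f : WithTop ℝ) = T.inf (fun h => h x + (a h : WithTop ℝ)) ∧
    g x + (a g : WithTop ℝ) = T.inf (fun h => h x + (a h : WithTop ℝ))

/-- A finite set of functions `X → ℝ ∪ {∞}`, none identically `∞`, is tropically independent
if it is not tropically dependent. -/
def TropicallyIndependent {X : Type*} (T : Finset (X → WithTop ℝ)) : Prop :=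
  (∀ f ∈ T, f ≠ (⊤ : X → WithTop ℝ)) ∧ ¬ TropicallyDependent T

open Classical

/-- The set of points where a real-valued function attains its infimum (assuming it does). -/
def argminSet {X : Type*} (φ : X → ℝ) : Set X := { x | ∀ y, φ x ≤ φ y }

/-- If `φ_0, …, φ_k : X → ℝ` each attain their infimum and their minimizer sets are strictly
nested, `argmin(φ_0) ⊋ argmin(φ_1) ⊋ ⋯ ⊋ argmin(φ_k)`, then `{φ_0, …, φ_k}` consists of `k + 1`
distinct functions and is tropically independent. -/
theorem tropicallyIndependent_of_strictly_nested_argmin {X : Type*} [Nonempty X] (k : ℕ)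
    (φ : Fin (k + 1) → X → ℝ) (hattain : ∀ i, (argminSet (φ i)).Nonempty)
    (hnested : ∀ i : Fin k, argminSet (φ i.succ) ⊂ argminSet (φ i.castSucc)) :
    (Finset.image (fun i : Fin (k + 1) => (fun x => ((φ i x : ℝ) : WithTop ℝ)))
        Finset.univ).card = k + 1 ∧
    TropicallyIndependent
      (Finset.image (fun i : Fin (k + 1) => (fun x => ((φ i x : ℝ) : WithTop ℝ)))
        Finset.univ) := by
  have hanti : StrictAnti (fun i => argminSet (φ i)) :=
    Fin.strictAnti_iff_succ_lt.2 hnested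
  have hinj : Function.Injective
      (fun i : Fin (k + 1) => (fun x => ((φ i x : ℝ) : WithTop ℝ))) := by
    intro i j hij
    apply hanti.injective
    have : φ i = φ j := by
      funext x
      exact WithTop.coe_injective (congrFun hij x)
    simp only [this]
  refine ⟨by rw [Finset.card_image_of_injective _ hinj]; simp, ?_, ?_⟩
  · intro f hf h
    obtain ⟨i, -, rfl⟩ := Finset.mem_image.1 hf
    obtain ⟨x, -⟩ := hattain i
    exact WithTop.coe_ne_top (congrFun h x)
  · rintro ⟨a, ha⟩
    let b : Fin (k + 1) → ℝ := fun i => a (fun x => ((φ i x : ℝ) : WithTop ℝ))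
    choose p hp using hattain
    let c : Fin (k + 1) → ℝ := fun i => φ i (p i) + b i
    obtain ⟨i0, hi0⟩ := Finite.exists_min c
    obtain ⟨j, hj, hjmin⟩ := (wellFounded_lt (α := Fin (k + 1))).has_min
      {i | ∀ i', c i ≤ c i'} ⟨i0, hi0⟩
    have hx : ∃ x ∈ argminSet (φ j), ∀ i, j < i → x ∉ argminSet (φ i) := by
      induction j using Fin.lastCases with
      | last => exact ⟨p _, hp _, fun i hi => absurd (Fin.le_last i) (not_le.2 hi)⟩
      | cast j =>
        obtain ⟨x, hx, hx'⟩ := Set.exists_of_ssubset (hnested j)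
        refine ⟨x, hx, fun i hi h => hx' (hanti.antitone ?_ h)⟩
        exact Fin.castSucc_lt_iff_succ_le.1 hi
    obtain ⟨x, hxj, hxi⟩ := hx
    have huniq : ∀ i, i ≠ j → φ j x + b j < φ i x + b i := by
      intro i hij
      have h1 : φ j x ≤ φ j (p j) := hxj _
      have h2 : φ i (p i) ≤ φ i x := hp i x
      have h3 : φ j (p j) + b j ≤ φ i (p i) + b i := hj i
      rcases lt_or_gt_of_ne hij with h | h
      · have h4 : c j < c i := by
          by_contra h5
          exact hjmin i (fun i' => (not_lt.1 h5).trans (hj i')) h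
        have h5 : φ j (p j) + b j < φ i (p i) + b i := h4
        linarith
      · have h4 : φ i (p i) < φ i x := by
          by_contra h5
          exact hxi i h (fun y => (not_lt.1 h5).trans (hp i y))
        linarith
    obtain ⟨f, hf, g, hg, hfg, hfe, hge⟩ := ha x
    obtain ⟨i, -, rfl⟩ := Finset.mem_image.1 hf
    obtain ⟨i', -, rfl⟩ := Finset.mem_image.1 hg
    have key : ∀ i, ((φ i x : ℝ) : WithTop ℝ) + (b i : WithTop ℝ) =
        (Finset.image (fun i : Fin (k + 1) => (fun x => ((φ i x : ℝ) : WithTop ℝ)))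
        Finset.univ).inf (fun h => h x + (a h : WithTop ℝ)) → i = j := by
      intro i hi
      by_contra hne
      have h1 := Finset.inf_le (f := fun h : X → WithTop ℝ => h x + (a h : WithTop ℝ))
        (Finset.mem_image_of_mem (fun i : Fin (k + 1) => (fun x => ((φ i x : ℝ) : WithTop ℝ)))
          (Finset.mem_univ j))
      rw [← hi] at h1
      have h2 : φ i x + b i ≤ φ j x + b j := by exact_mod_cast h1
      exact absurd (huniq i hne) (not_lt.2 h2)
    exact hfg (by rw [key i hfe, key i' hge])
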